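/- Let d ≡ 3 (mod 4), q ≡ 3 (mod 4) be a prime power, and let E ⊆ P_d ⊆ 𝔽_q^d. Suppose that there is a constant C₁ > 0 such that for every r ∈ 𝔽_q \ {0} and every function f : S_r → ℂ on the sphere S_r ⊆ 𝔽_q^{d-1}, the extension estimate ( Σ_{c ∈ 𝔽_q^{d-1}} | |S_r|^{-1} Σ_{x ∈ S_r} χ(c·x) f(x) |^{(2d+2)/(d-1)} )^{(d-1)/(2d+2)} ≤ C₁ ( |S_r|^{-1} Σ_{x ∈ S_r} |f(x)|² )^{1/2} holds. Then there exist constants C, c > 0 depending only on C₁ such that if |E| ≥ C q^{(d²-1)/(2d)}, then |∏(E)| ≥ c q. -/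

import Mathlib

open Finset

/-- Dot product `x·y = x₁y₁ + ⋯ + xₙyₙ` on `𝔽_q^n`. -/
def dotP {F : Type*} [CommRing F] {n : ℕ} (x y : Fin n → F) : F := ∑ i, x i * y i

/-- The "norm" `‖x‖ = x₁² + ⋯ + xₙ²` on `𝔽_q^n`. -/
def nrm {F : Type*} [CommRing F] {n : ℕ} (x : Fin n → F) : F := ∑ i, x i * x i

/-- The sphere `S_r = {x ∈ 𝔽_q^n : ‖x‖ = r}`. -/
def sph (F : Type*) [CommRing F] [Fintype F] [DecidableEq F] (n : ℕ) (r : F) :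
    Finset (Fin n → F) := Finset.univ.filter fun x => nrm x = r

/-- The dot product set `∏(E) = {x·y : x, y ∈ E}`. -/
def prodSet {F : Type*} [CommRing F] [DecidableEq F] {n : ℕ} (E : Finset (Fin n → F)) :
    Finset F := (E ×ˢ E).image fun p => dotP p.1 p.2

/-- Fourier transform of the indicator function of `X`:
`X̂(m) = q^{-n} ∑_{x ∈ X} χ(-x·m)`. -/
noncomputable def fourierCoef {F : Type*} [CommRing F] [Fintype F] {n : ℕ}
    (χ : AddChar F ℂ) (X : Finset (Fin n → F)) (m : Fin n → F) : ℂ :=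
  ((Fintype.card F : ℂ) ^ n)⁻¹ * ∑ x ∈ X, χ (-(dotP x m))

theorem dotP_sub_right {R : Type*} [CommRing R] {n : ℕ} (m x y : Fin n → R) : dotP m (x - y) = dotP m x - dotP m y := by
  simp [dotP, mul_sub]

theorem dotP_neg_left {R : Type*} [CommRing R] {n : ℕ} (x y : Fin n → R) : dotP (-x) y = -dotP x y := by
  simp [dotP]

theorem dotP_comm {R : Type*} [CommRing R] {n : ℕ} (x y : Fin n → R) : dotP x y = dotP y x := by
  simp [dotP, mul_comm]

theorem addChar_map_sum {ι G R : Type*} [AddCommMonoid G] [CommMonoid R] (χ : AddChar G R)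
    (s : Finset ι) (f : ι → G) : χ (∑ i ∈ s, f i) = ∏ i ∈ s, χ (f i) := by
  classical
  induction s using Finset.induction_on with
  | empty => simp
  | insert a s ha ih => rw [sum_insert ha, prod_insert ha, AddChar.map_add_eq_mul, ih]

theorem three_le_card_of_mod_four {α : Type*} [Fintype α] (hα : Fintype.card α % 4 = 3) :
    (3 : ℝ) ≤ Fintype.card α := by
  have : 3 ≤ Fintype.card α := by omega
  exact_mod_cast this

section CharacterSums

variable {F : Type*} [Field F] [Fintype F]

theorem ringChar_ne_two_of_card_mod_four (hq : Fintype.card F % 4 = 3) : ringChar F ≠ 2 := by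
  intro h
  have := FiniteField.even_card_of_char_two h
  omega

theorem two_ne_zero_of_card_mod_four (hq : Fintype.card F % 4 = 3) : (2 : F) ≠ 0 :=
  Ring.two_ne_zero (ringChar_ne_two_of_card_mod_four hq)

theorem four_ne_zero_of_card_mod_four (hq : Fintype.card F % 4 = 3) : (4 : F) ≠ 0 := by
  have := two_ne_zero_of_card_mod_four hq
  rw [show (4 : F) = 2 * 2 by norm_num]
  exact mul_ne_zero this this

theorem sum_addChar_quadratic (h2 : (2 : F) ≠ 0) (χ : AddChar F ℂ) {s : F} (hs : s ≠ 0) (m : F) :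
    ∑ x : F, χ (s * (x * x) + m * x) =
      χ (-(4 * s)⁻¹ * (m * m)) * ∑ x : F, χ (s * (x * x)) := by
  rw [mul_sum, ← Equiv.sum_comp (Equiv.addRight (-(2 * s)⁻¹ * m))]
  refine sum_congr rfl fun x _ => ?_
  rw [← AddChar.map_add_eq_mul]
  congr 1
  have h4 : (4 : F) = 2 * 2 := by norm_num
  simp only [Equiv.coe_addRight, h4]
  field_simp
  ring

variable [DecidableEq F]

/-- The square of the quadratic Gauss sum over a field with `q ≡ 3 (mod 4)` elements is `-q`. -/
theorem sum_addChar_mul_self_sq (hq : Fintype.card F % 4 = 3) {χ : AddChar F ℂ} (hχ : χ ≠ 1)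
    {s : F} (hs : s ≠ 0) : (∑ x : F, χ (s * (x * x))) ^ 2 = -(Fintype.card F : ℂ) := by
  have hF := ringChar_ne_two_of_card_mod_four hq
  set η : MulChar F ℂ := (quadraticChar F).ringHomComp (Int.castRingHom ℂ) with hη
  have hηq : η.IsQuadratic := (quadraticChar_isQuadratic F).comp _
  have hm1 : η (-1) = -1 := by
    simp [hη, MulChar.ringHomComp_apply, quadraticChar_neg_one hF,
      ZMod.χ₄_nat_three_mod_four hq]
  have hη1 : η ≠ 1 := by
    intro h
    rw [h, MulChar.one_apply (by simp)] at hm1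
    norm_num at hm1
  have hprim := AddChar.IsPrimitive.of_ne_one hχ
  have hψ1 : AddChar.mulShift χ s ≠ 1 := hprim hs
  have key : ∑ x : F, χ (s * (x * x)) = gaussSum η (AddChar.mulShift χ s) := by
    rw [← sum_fiberwise univ (fun x : F => x * x), gaussSum]
    have h1 : ∀ a : F, ∑ x with x * x = a, χ (s * (x * x)) = (η a + 1) * χ (s * a) := by
      intro a
      rw [sum_congr rfl (g := fun _ => χ (s * a))
        (fun x hx => by rw [(mem_filter.1 hx).2]), sum_const, nsmul_eq_mul]
      congr 1
      have := quadraticChar_card_sqrts hF a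
      rw [hη, MulChar.ringHomComp_apply]
      have h2 : ({x : F | x ^ 2 = a}.toFinset) = univ.filter fun x : F => x * x = a := by
        ext x; simp [sq]
      rw [h2] at this
      have h3 := congrArg (Int.cast : ℤ → ℂ) this
      push_cast at h3
      simpa using h3
    simp_rw [h1, add_mul, one_mul, sum_add_distrib]
    have h0 : ∑ a : F, χ (s * a) = 0 := by
      simpa [AddChar.mulShift_apply] using AddChar.sum_eq_zero_of_ne_one hψ1
    rw [h0, add_zero]
    rfl
  rw [key, gaussSum_sq hη1 hηq (AddChar.IsPrimitive.of_ne_one hψ1), hm1]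
  ring

/-- Gaussian character sums in even dimension `2h`, `h` odd, over a field with
`q ≡ 3 (mod 4)` elements: the sign of the Gauss sum is negative. -/
theorem sum_addChar_nrm (hq : Fintype.card F % 4 = 3) {χ : AddChar F ℂ} (hχ : χ ≠ 1)
    {n h : ℕ} (hn : n = 2 * h) (hh : Odd h) {s : F} (hs : s ≠ 0) (m : Fin n → F) :
    ∑ w : Fin n → F, χ (s * nrm w + dotP m w) =
      -(Fintype.card F : ℂ) ^ h * χ (-(4 * s)⁻¹ * nrm m) := by
  subst hn
  have h2 := two_ne_zero_of_card_mod_four hq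
  have h1 : ∀ w : Fin (2 * h) → F, χ (s * nrm w + dotP m w) =
      ∏ i, χ (s * (w i * w i) + m i * w i) := by
    intro w
    rw [← addChar_map_sum, nrm, dotP, mul_sum, sum_add_distrib]
  simp_rw [h1]
  rw [← Fintype.prod_sum (fun (i : Fin (2 * h)) (x : F) => χ (s * (x * x) + m i * x))]
  simp_rw [sum_addChar_quadratic h2 χ hs]
  rw [prod_mul_distrib, ← addChar_map_sum, ← mul_sum, prod_const, card_univ, Fintype.card_fin,
    pow_mul, sum_addChar_mul_self_sq hq hχ hs, hh.neg_pow, mul_comm]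
  rfl

theorem sum_addChar_dotP {χ : AddChar F ℂ} (hχ : χ ≠ 1) {n : ℕ} (w : Fin n → F) :
    ∑ m : Fin n → F, χ (dotP m w) = if w = 0 then (Fintype.card F : ℂ) ^ n else 0 := by
  have hprim := AddChar.IsPrimitive.of_ne_one hχ
  simp_rw [dotP, addChar_map_sum]
  rw [← Fintype.prod_sum (fun (i : Fin n) (x : F) => χ (x * w i))]
  simp_rw [AddChar.sum_mulShift _ hprim]
  split_ifs with hw
  · simp [hw]
  · obtain ⟨i, hi⟩ := Function.ne_iff.1 hw
    exact prod_eq_zero (mem_univ i) (by simpa using hi)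

/-- Parseval's identity for a kernel with orthogonal columns. -/
theorem sum_norm_sq_of_orthogonal {α β : Type*} [Fintype α] [Fintype β] [DecidableEq β]
    (k : α → β → ℂ) (N : ℝ)
    (hk : ∀ x y, ∑ m, k m x * (starRingEnd ℂ) (k m y) = if x = y then (N : ℂ) else 0)
    (g : β → ℂ) : ∑ m, ‖∑ x, k m x * g x‖ ^ 2 = N * ∑ x, ‖g x‖ ^ 2 := by
  have : ((∑ m, ‖∑ x, k m x * g x‖ ^ 2 : ℝ) : ℂ) = ((N * ∑ x, ‖g x‖ ^ 2 : ℝ) : ℂ) := by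
    push_cast
    simp_rw [← Complex.mul_conj', map_sum, map_mul, sum_mul_sum]
    rw [sum_comm, mul_sum]
    refine sum_congr rfl fun x _ => ?_
    rw [sum_comm]
    have : ∀ y, ∑ m, k m x * g x * ((starRingEnd ℂ) (k m y) * (starRingEnd ℂ) (g y)) =
        (if x = y then (N : ℂ) else 0) * (g x * (starRingEnd ℂ) (g y)) := by
      intro y
      rw [← hk, sum_mul]
      exact sum_congr rfl fun m _ => by ring
    simp_rw [this]
    simp
  exact_mod_cast this

theorem parseval_field {χ : AddChar F ℂ} (hχ : χ ≠ 1) (g : F → ℂ) :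
    ∑ s : F, ‖∑ t, χ (s * t) * g t‖ ^ 2 = (Fintype.card F : ℝ) * ∑ t, ‖g t‖ ^ 2 := by
  refine sum_norm_sq_of_orthogonal (fun s t => χ (s * t)) _ (fun x y => ?_) g
  simp_rw [← AddChar.map_neg_eq_conj, ← AddChar.map_add_eq_mul]
  have := AddChar.sum_mulShift (x - y) (AddChar.IsPrimitive.of_ne_one hχ)
  simp only [sub_eq_zero] at this
  rw [show (if x = y then ((Fintype.card F : ℝ) : ℂ) else 0) =
    ((if x = y then Fintype.card F else 0 : ℕ) : ℂ) by split_ifs <;> simp, ← this]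
  exact sum_congr rfl fun s _ => by congr 1; ring

theorem parseval_indicator {χ : AddChar F ℂ} (hχ : χ ≠ 1) {n : ℕ} (E : Finset (Fin n → F)) :
    ∑ m : Fin n → F, ‖∑ y ∈ E, χ (dotP m y)‖ ^ 2 = (Fintype.card F : ℝ) ^ n * #E := by
  have := sum_norm_sq_of_orthogonal (fun m y : Fin n → F => χ (dotP m y))
    ((Fintype.card F : ℝ) ^ n) (fun x y => ?_) (fun y => if y ∈ E then 1 else 0)
  · convert this using 2
    · simp
    · simp [apply_ite norm, ite_pow]
  · simp_rw [← AddChar.map_neg_eq_conj, ← AddChar.map_add_eq_mul, ← sub_eq_add_neg,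
      ← dotP_sub_right]
    rw [sum_addChar_dotP hχ]
    simp [sub_eq_zero]

/-- The number of points of `E` at "distance" `t` from `v`. -/
def pinnedCount {n : ℕ} (E : Finset (Fin n → F)) (v : Fin n → F) (t : F) : ℕ :=
  #{y ∈ E | nrm (y - v) = t}

/-- The extension operator for the sphere `S_r` (without normalisation), applied to the Fourier
transform of the indicator function of `E` and evaluated at `-v`. -/
noncomputable def sphereSum (χ : AddChar F ℂ) {n : ℕ} (E : Finset (Fin n → F)) (r : F)
    (v : Fin n → F) : ℂ :=
  ∑ m ∈ sph F n r, χ (dotP (-v) m) * ∑ y ∈ E, χ (dotP m y)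

theorem sum_sph {n : ℕ} (f : (Fin n → F) → ℂ) :
    ∑ r : F, ∑ m ∈ sph F n r, f m = ∑ m, f m :=
  sum_fiberwise univ (fun m : Fin n → F => nrm m) f

theorem sum_addChar_mul_pinnedCount (χ : AddChar F ℂ) {n : ℕ} (E : Finset (Fin n → F))
    (v : Fin n → F) (s : F) :
    ∑ t, χ (s * t) * (pinnedCount E v t : ℂ) = ∑ y ∈ E, χ (s * nrm (y - v)) := by
  rw [← sum_fiberwise E (fun y => nrm (y - v))]
  refine sum_congr rfl fun t _ => ?_
  rw [sum_congr rfl (g := fun _ => χ (s * t)) (fun y hy => by rw [(mem_filter.1 hy).2]),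
    sum_const, nsmul_eq_mul, mul_comm]
  rfl

theorem sum_pinnedCount {n : ℕ} (E : Finset (Fin n → F)) (v : Fin n → F) :
    ∑ t, pinnedCount E v t = #E :=
  (card_eq_sum_card_fiberwise (t := univ) fun _ _ => by simp).symm

theorem addChar_mul_sphereSum (χ : AddChar F ℂ) {n : ℕ} (E : Finset (Fin n → F)) (u : F)
    (v : Fin n → F) :
    ∑ r, χ (u * r) * sphereSum χ E r v =
      ∑ y ∈ E, ∑ m : Fin n → F, χ (u * nrm m + dotP (y - v) m) := by
  rw [sum_comm, ← sum_sph]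
  refine sum_congr rfl fun r _ => ?_
  rw [sphereSum, mul_sum]
  refine sum_congr rfl fun m hm => ?_
  have hm : nrm m = r := (mem_filter.1 hm).2
  rw [mul_sum, mul_sum]
  refine sum_congr rfl fun y _ => ?_
  rw [← AddChar.map_add_eq_mul, ← AddChar.map_add_eq_mul, hm]
  congr 2
  rw [dotP_neg_left, dotP_comm (y - v), dotP_sub_right, dotP_comm m v]
  ring

theorem addChar_mul_sphereSum_eq (hq : Fintype.card F % 4 = 3) {χ : AddChar F ℂ} (hχ : χ ≠ 1)
    {n h : ℕ} (hn : n = 2 * h) (hh : Odd h) (E : Finset (Fin n → F)) {u : F} (hu : u ≠ 0)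
    (v : Fin n → F) :
    ∑ r, χ (u * r) * sphereSum χ E r v =
      -(Fintype.card F : ℂ) ^ h * ∑ t, χ (-(4 * u)⁻¹ * t) * (pinnedCount E v t : ℂ) := by
  rw [addChar_mul_sphereSum, sum_addChar_mul_pinnedCount, mul_sum]
  exact sum_congr rfl fun y _ => sum_addChar_nrm hq hχ hn hh hu _

theorem sum_sphereSum {χ : AddChar F ℂ} (hχ : χ ≠ 1) {n : ℕ} (E : Finset (Fin n → F))
    (v : Fin n → F) :
    ∑ r, sphereSum χ E r v = (Fintype.card F : ℂ) ^ n * if v ∈ E then 1 else 0 := by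
  have := addChar_mul_sphereSum χ E 0 v
  simp only [zero_mul, AddChar.map_zero_eq_one, one_mul, zero_add] at this
  rw [this]
  have h : ∀ y, ∑ m, χ (dotP m (y - v)) = if y = v then (Fintype.card F : ℂ) ^ n else 0 := by
    intro y
    rw [sum_addChar_dotP hχ]
    simp [sub_eq_zero]
  simp_rw [dotP_comm (_ - v) _, h]
  simp

theorem sum_ne_zero_inv {M : Type*} [AddCommMonoid M] (h4 : (4 : F) ≠ 0) (f : F → M) :
    ∑ u ∈ univ.erase (0 : F), f (-(4 * u)⁻¹) = ∑ s ∈ univ.erase (0 : F), f s := by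
  refine sum_nbij' (fun u => -(4 * u)⁻¹) (fun u => -(4 * u)⁻¹) ?_ ?_ ?_ ?_ ?_
  · intro u hu
    simpa [h4] using hu
  · intro u hu
    simpa [h4] using hu
  · intro u hu
    have : u ≠ 0 := by simpa using hu
    field_simp
  · intro u hu
    have : u ≠ 0 := by simpa using hu
    field_simp
  · intro u _
    rfl

/-- Explicit value of the sphere sum of radius zero. -/
theorem sphereSum_zero (hq : Fintype.card F % 4 = 3) {χ : AddChar F ℂ} (hχ : χ ≠ 1)
    {n h : ℕ} (hn : n = 2 * h) (hh : Odd h) (E : Finset (Fin n → F)) (v : Fin n → F) :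
    (Fintype.card F : ℂ) * sphereSum χ E 0 v =
      (Fintype.card F : ℂ) ^ n * (if v ∈ E then 1 else 0) + (Fintype.card F : ℂ) ^ h * #E
        - (Fintype.card F : ℂ) ^ (h + 1) * pinnedCount E v 0 := by
  have key : ∀ g : F → ℂ, ∑ u, ∑ r, χ (u * r) * g r = (Fintype.card F : ℂ) * g 0 := by
    intro g
    rw [sum_comm]
    simp_rw [← sum_mul, AddChar.sum_mulShift _ (AddChar.IsPrimitive.of_ne_one hχ)]
    simp
  have h0 : ∀ g : F → ℂ, ∑ u ∈ univ.erase (0 : F), ∑ r, χ (u * r) * g r =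
      (Fintype.card F : ℂ) * g 0 - ∑ r, g r := by
    intro g
    rw [← key, ← add_sum_erase univ _ (mem_univ (0 : F))]
    simp
  have h1 := h0 fun r => sphereSum χ E r v
  have h2 := h0 fun t => (pinnedCount E v t : ℂ)
  rw [sum_sphereSum hχ] at h1
  rw [← sum_ne_zero_inv (four_ne_zero_of_card_mod_four hq), ← Nat.cast_sum,
    sum_pinnedCount] at h2
  rw [sum_congr rfl fun u hu =>
    addChar_mul_sphereSum_eq hq hχ hn hh E (by simpa using hu) v, ← mul_sum, h2] at h1
  linear_combination -h1

theorem sum_sq_pinnedCount_le (hq : Fintype.card F % 4 = 3) {χ : AddChar F ℂ} (hχ : χ ≠ 1)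
    {n h : ℕ} (hn : n = 2 * h) (hh : Odd h) (E : Finset (Fin n → F)) (v : Fin n → F) :
    (Fintype.card F : ℝ) ^ n * (Fintype.card F * ∑ t, (pinnedCount E v t : ℝ) ^ 2) ≤
      (Fintype.card F : ℝ) ^ n * (#E : ℝ) ^ 2 +
        Fintype.card F * ∑ r, ‖sphereSum χ E r v‖ ^ 2 := by
  have h1 := parseval_field hχ (fun t => (pinnedCount E v t : ℂ))
  have h2 := parseval_field hχ (fun r => sphereSum χ E r v)
  simp only [Complex.norm_natCast] at h1
  rw [← h1, ← h2, ← add_sum_erase univ _ (mem_univ (0 : F)), mul_add]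
  refine add_le_add (le_of_eq ?_) ?_
  · simp only [zero_mul, AddChar.map_zero_eq_one, one_mul]
    rw [← Nat.cast_sum, sum_pinnedCount, Complex.norm_natCast]
  · have hn2 : (Fintype.card F : ℝ) ^ n = ((Fintype.card F : ℝ) ^ h) ^ 2 := by
      rw [hn, ← pow_mul, mul_comm]
    rw [← add_sum_erase univ _ (mem_univ (0 : F)),
      ← sum_ne_zero_inv (four_ne_zero_of_card_mod_four hq), mul_sum]
    refine le_add_of_nonneg_of_le (by positivity) (le_of_eq ?_)
    refine sum_congr rfl fun u hu => ?_
    rw [addChar_mul_sphereSum_eq hq hχ hn hh E (by simpa using hu) v, norm_mul, mul_pow, norm_neg,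
      norm_pow, Complex.norm_natCast, hn2]

theorem norm_sum_sphereSum_le {χ : AddChar F ℂ} (hχ : χ ≠ 1) {n : ℕ}
    (E V : Finset (Fin n → F)) (r : F) :
    ‖∑ v ∈ V, sphereSum χ E r v‖ ^ 2 ≤ ((Fintype.card F : ℝ) ^ n) ^ 2 * (#V * #E) := by
  have h1 : ∑ v ∈ V, sphereSum χ E r v =
      ∑ m ∈ sph F n r, (starRingEnd ℂ) (∑ v ∈ V, χ (dotP m v)) * ∑ y ∈ E, χ (dotP m y) := by
    simp_rw [sphereSum]
    rw [sum_comm]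
    refine sum_congr rfl fun m _ => ?_
    rw [← sum_mul, map_sum]
    congr 1
    exact sum_congr rfl fun v _ => by
      rw [← AddChar.map_neg_eq_conj, dotP_neg_left, dotP_comm]
  have h2 : ‖∑ v ∈ V, sphereSum χ E r v‖ ≤
      ∑ m, ‖∑ v ∈ V, χ (dotP m v)‖ * ‖∑ y ∈ E, χ (dotP m y)‖ := by
    rw [h1]
    refine (norm_sum_le _ _).trans ?_
    simp_rw [norm_mul, Complex.norm_conj]
    exact sum_le_sum_of_subset_of_nonneg (subset_univ _) fun _ _ _ => by positivity
  calc _ ≤ (∑ m, ‖∑ v ∈ V, χ (dotP m v)‖ * ‖∑ y ∈ E, χ (dotP m y)‖) ^ 2 := by gcongr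
    _ ≤ _ := sum_mul_sq_le_sq_mul_sq _ _ _
    _ = _ := by rw [parseval_indicator hχ, parseval_indicator hχ]; ring

theorem sum_sph_parseval {χ : AddChar F ℂ} (hχ : χ ≠ 1) {n : ℕ} (E : Finset (Fin n → F)) :
    ∑ r : F, ∑ m ∈ sph F n r, ‖∑ y ∈ E, χ (dotP m y)‖ ^ 2 = (Fintype.card F : ℝ) ^ n * #E := by
  rw [← parseval_indicator hχ]
  exact sum_fiberwise univ (fun m : Fin n → F => nrm m) _

theorem sum_pinnedCount_zero_le (hq : Fintype.card F % 4 = 3) {χ : AddChar F ℂ} (hχ : χ ≠ 1)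
    {n h : ℕ} (hn : n = 2 * h) (hh : Odd h) (E V : Finset (Fin n → F))
    (hV : 12 * (Fintype.card F : ℝ) ^ h ≤ #V) (hE : 12 * (Fintype.card F : ℝ) ^ h ≤ #E) :
    ∑ v ∈ V, (pinnedCount E v 0 : ℝ) ≤ #V * #E / 2 := by
  set Q : ℝ := (Fintype.card F : ℝ) with hQ
  have hQ3 : 3 ≤ Q := three_le_card_of_mod_four hq
  set A : ℝ := (#V : ℝ)
  set B : ℝ := (#E : ℝ)
  have hA0 : 0 ≤ A := by positivity
  have hB0 : 0 ≤ B := by positivity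
  set M := √(A * B) with hM
  have hM0 : 0 ≤ M := Real.sqrt_nonneg _
  have hM2 : M ^ 2 = A * B := Real.sq_sqrt (by positivity)
  have hP : 0 < Q ^ h := by positivity
  have hMP : 12 * Q ^ h ≤ M := by
    refine Real.le_sqrt_of_sq_le ?_
    rw [sq]
    exact mul_le_mul hV hE (by positivity) hA0
  set I : ℝ := ∑ v ∈ V, if v ∈ E then (1 : ℝ) else 0 with hI
  have hIM : I ≤ M := by
    have hIc : I = (#{v ∈ V | v ∈ E} : ℝ) := by simp [hI, filter_mem_eq_inter]
    have h1 : I ≤ A := by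
      rw [hIc]; exact Nat.cast_le.2 (card_le_card (filter_subset _ _))
    have h2 : I ≤ B := by
      rw [hIc]; exact Nat.cast_le.2 (card_le_card fun v hv => (mem_filter.1 hv).2)
    refine Real.le_sqrt_of_sq_le ?_
    rw [sq]
    exact mul_le_mul h1 h2 (by rw [hIc]; positivity) hA0
  set Z : ℝ := ∑ v ∈ V, (pinnedCount E v 0 : ℝ) with hZ
  have hΦ : ‖∑ v ∈ V, sphereSum χ E 0 v‖ ≤ Q ^ n * M := by
    refine le_of_sq_le_sq ?_ (by positivity)
    rw [mul_pow, hM2]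
    exact norm_sum_sphereSum_le hχ E V 0
  have hsum : (Q : ℂ) * ∑ v ∈ V, sphereSum χ E 0 v =
      ((Q ^ n * I + Q ^ h * (A * B) - Q ^ (h + 1) * Z : ℝ) : ℂ) := by
    rw [mul_sum, hQ, Complex.ofReal_natCast,
      sum_congr rfl fun v _ => sphereSum_zero hq hχ hn hh E v]
    rw [sum_sub_distrib, sum_add_distrib, ← mul_sum, ← mul_sum, ← mul_sum, sum_const, nsmul_eq_mul,
      hI, hZ]
    push_cast
    simp only [A, B, apply_ite (Complex.ofReal), Complex.ofReal_one, Complex.ofReal_zero,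
      Complex.ofReal_natCast]
  have hnorm := congrArg norm hsum
  rw [norm_mul, Complex.norm_real, Complex.norm_real, Real.norm_of_nonneg (by positivity),
    Real.norm_eq_abs] at hnorm
  have h1 : Q ^ (h + 1) * Z ≤ Q ^ n * I + Q ^ h * (A * B) + Q * (Q ^ n * M) := by
    have := neg_abs_le (Q ^ n * I + Q ^ h * (A * B) - Q ^ (h + 1) * Z)
    rw [← hnorm] at this
    have := mul_le_mul_of_nonneg_left hΦ (by positivity : 0 ≤ Q)
    linarith
  have hn2 : Q ^ n = Q ^ h * Q ^ h := by rw [hn, two_mul, pow_add]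
  have h2 : Q * Z ≤ Q ^ h * I + A * B + Q * (Q ^ h * M) := by
    rw [hn2, pow_succ] at h1
    refine le_of_mul_le_mul_left ?_ hP
    linarith
  have h3 : Q ^ h * I ≤ Q ^ h * M := by gcongr
  have h4 : 12 * (Q ^ h * M) ≤ A * B := by rw [← hM2]; nlinarith
  have h5 : Q * (12 * (Q ^ h * M)) ≤ Q * (A * B) := by gcongr
  have h6 : 3 * (A * B) ≤ Q * (A * B) := by gcongr
  have hAB : 0 ≤ A * B := by positivity
  refine le_of_mul_le_mul_left ?_ (by positivity : 0 < Q)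
  linarith

theorem sum_erase_sq_pinnedCount_le (hq : Fintype.card F % 4 = 3) {χ : AddChar F ℂ}
    (hχ : χ ≠ 1) {n h : ℕ} (hn : n = 2 * h) (hh : Odd h) (E : Finset (Fin n → F))
    (hE : 12 * (Fintype.card F : ℝ) ^ h ≤ #E) (v : Fin n → F) :
    (Fintype.card F : ℝ) ^ n *
        (Fintype.card F * ∑ t ∈ univ.erase 0, (pinnedCount E v t : ℝ) ^ 2) ≤
      2 * (Fintype.card F : ℝ) ^ n * (#E : ℝ) ^ 2 +
        Fintype.card F * ∑ r ∈ univ.erase 0, ‖sphereSum χ E r v‖ ^ 2 := by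
  have h1 := sum_sq_pinnedCount_le hq hχ hn hh E v
  have h0 := congrArg norm (sphereSum_zero hq hχ hn hh E v)
  rw [← add_sum_erase univ _ (mem_univ (0 : F)),
    ← add_sum_erase univ (fun r => ‖sphereSum χ E r v‖ ^ 2) (mem_univ (0 : F))] at h1
  set Q : ℝ := (Fintype.card F : ℝ) with hQ
  have hQ3 : 3 ≤ Q := three_le_card_of_mod_four hq
  set B : ℝ := (#E : ℝ)
  set Z : ℝ := (pinnedCount E v 0 : ℝ)
  set X := ∑ t ∈ univ.erase 0, (pinnedCount E v t : ℝ) ^ 2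
  set Y := ∑ r ∈ univ.erase 0, ‖sphereSum χ E r v‖ ^ 2
  have hn2 : Q ^ n = Q ^ h * Q ^ h := by rw [hn, two_mul, pow_add]
  have hP : 0 < Q ^ h := by positivity
  set a : ℝ := Q ^ n * (if v ∈ E then 1 else 0) + Q ^ h * B with ha
  have ha0 : 0 ≤ a := by positivity
  have hB0 : 0 ≤ B := by positivity
  have ha2 : a ≤ Q ^ h * B * (13 / 12) := by
    have : Q ^ n * (if v ∈ E then (1 : ℝ) else 0) ≤ Q ^ n := by
      refine mul_le_of_le_one_right (by positivity) ?_
      split_ifs <;> norm_num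
    rw [ha]
    nlinarith
  have hsq : Q ^ 2 * ‖sphereSum χ E 0 v‖ ^ 2 = (a - Q ^ (h + 1) * Z) ^ 2 := by
    have : ((Fintype.card F : ℂ) ^ n * (if v ∈ E then 1 else 0) + (Fintype.card F : ℂ) ^ h * #E
        - (Fintype.card F : ℂ) ^ (h + 1) * pinnedCount E v 0) =
        ((a - Q ^ (h + 1) * Z : ℝ) : ℂ) := by
      simp only [ha, hQ, B, Z]
      push_cast
      simp only [apply_ite (Complex.ofReal), Complex.ofReal_one, Complex.ofReal_zero]
    rw [this, norm_mul, Complex.norm_real, Complex.norm_natCast, ← hQ, Real.norm_eq_abs] at h0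
    rw [← mul_pow, h0, sq_abs]
  have hZ0 : 0 ≤ Z := by positivity
  have h2 : Q ^ 2 * ‖sphereSum χ E 0 v‖ ^ 2 ≤
      Q * (Q ^ n * B ^ 2) + Q ^ 2 * (Q ^ n * Z ^ 2) := by
    rw [hsq, hn2]
    have h3 : a ^ 2 ≤ (Q ^ h * B * (13 / 12)) ^ 2 := by gcongr
    have h4 : 3 * (Q ^ h * B) ^ 2 ≤ Q * (Q ^ h * B) ^ 2 := by gcongr
    have h5 : 0 ≤ a * (Q ^ (h + 1) * Z) := by positivity
    have h6 : 0 ≤ (Q ^ h * B) ^ 2 := by positivity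
    rw [pow_succ Q h] at h5 ⊢
    linarith
  have h7 : Q * ‖sphereSum χ E 0 v‖ ^ 2 ≤ Q ^ n * B ^ 2 + Q * (Q ^ n * Z ^ 2) := by
    refine le_of_mul_le_mul_left ?_ (by positivity : 0 < Q)
    linarith
  rw [mul_add, mul_add, mul_add] at h1
  linarith

/-- Pinned distance sets: if the extension operators of the spheres of nonzero radius satisfy
an `L²` bound over `V`, then some `v ∈ V` determines a positive proportion of all distances
to `E`. -/
theorem exists_card_pinned_le (hq : Fintype.card F % 4 = 3) {χ : AddChar F ℂ} (hχ : χ ≠ 1)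
    {n h : ℕ} (hn : n = 2 * h) (hh : Odd h) (E V : Finset (Fin n → F)) (K : ℝ)
    (hK : ∀ r : F, r ≠ 0 → ∑ v ∈ V, ‖sphereSum χ E r v‖ ^ 2 ≤
      K * ∑ m ∈ sph F n r, ‖∑ y ∈ E, χ (dotP m y)‖ ^ 2) (hK0 : 0 ≤ K)
    (hV : 12 * (Fintype.card F : ℝ) ^ h ≤ #V) (hE : 12 * (Fintype.card F : ℝ) ^ h ≤ #E)
    (hKVE : K * Fintype.card F ≤ #V * #E) :
    ∃ v ∈ V, (Fintype.card F : ℝ) ≤ 24 * #(E.image fun y => nrm (y - v)) := by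
  by_contra! hcon
  have hZ := sum_pinnedCount_zero_le hq hχ hn hh E V hV hE
  have hX := sum_le_sum fun v (_ : v ∈ V) => sum_erase_sq_pinnedCount_le hq hχ hn hh E hE v
  have hparts := sum_sph_parseval hχ E
  set Q : ℝ := (Fintype.card F : ℝ) with hQ
  have hQ3 : 3 ≤ Q := three_le_card_of_mod_four hq
  have hP : 0 < Q ^ h := by positivity
  set A : ℝ := (#V : ℝ) with hA
  set B : ℝ := (#E : ℝ)
  have hA0 : 0 < A := by linarith
  have hB0 : 0 < B := by linarith
  set X : (Fin n → F) → ℝ := fun v => ∑ t ∈ univ.erase 0, (pinnedCount E v t : ℝ) ^ 2 with hXdef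
  have hsX : Q * ∑ v ∈ V, X v ≤ 3 * A * B ^ 2 := by
    have h1 : ∑ v ∈ V, ∑ r ∈ univ.erase (0 : F), ‖sphereSum χ E r v‖ ^ 2 ≤ K * (Q ^ n * B) := by
      rw [sum_comm, ← hparts, mul_sum]
      refine (sum_le_sum fun r hr => hK r (by simpa using hr)).trans ?_
      exact sum_le_sum_of_subset_of_nonneg (erase_subset _ _) fun _ _ _ =>
        mul_nonneg hK0 (sum_nonneg fun _ _ => by positivity)
    rw [← mul_sum, ← mul_sum, sum_add_distrib, sum_const, nsmul_eq_mul, ← mul_sum] at hX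
    have h2 : Q * (K * (Q ^ n * B)) ≤ A * B * (Q ^ n * B) := by
      rw [← mul_assoc, mul_comm Q K]
      gcongr
    have h3 := mul_le_mul_of_nonneg_left h1 (by positivity : 0 ≤ Q)
    refine le_of_mul_le_mul_left ?_ (by positivity : 0 < Q ^ n)
    linarith
  set x : (Fin n → F) → ℝ := fun v => ∑ t ∈ univ.erase (0 : F), (pinnedCount E v t : ℝ)
  have hx : A * B / 2 ≤ ∑ v ∈ V, x v := by
    have h1 : ∀ v, x v = B - pinnedCount E v 0 := by
      intro v
      have := sum_pinnedCount E v
      rw [← add_sum_erase univ _ (mem_univ (0 : F))] at this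
      have := congrArg (Nat.cast : ℕ → ℝ) this
      push_cast at this
      simp only [x, B]
      linarith
    simp_rw [h1, sum_sub_distrib, sum_const, nsmul_eq_mul]
    linarith
  have hxX : ∀ v ∈ V, 24 * x v ^ 2 ≤ Q * X v := by
    intro v hv
    set D := E.image fun y => nrm (y - v) with hD
    have hsub : ∀ g : ℕ → ℝ, g 0 = 0 → ∑ t ∈ univ.erase (0 : F), g (pinnedCount E v t) =
        ∑ t ∈ D.erase 0, g (pinnedCount E v t) := by
      intro g hg
      refine (sum_subset (erase_subset_erase _ (subset_univ _)) fun t ht ht' => ?_).symm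
      have htD : t ∉ D := fun h => ht' (mem_erase.2 ⟨(mem_erase.1 ht).1, h⟩)
      have : pinnedCount E v t = 0 := by
        refine card_eq_zero.2 (filter_eq_empty_iff.2 fun y hy hyt => htD ?_)
        exact mem_image.2 ⟨y, hy, hyt⟩
      rw [this, hg]
    have h1 := hsub (fun k => (k : ℝ)) (by simp)
    have h2 := hsub (fun k => (k : ℝ) ^ 2) (by simp)
    simp only [x, X]
    rw [h1, h2]
    have h3 := sq_sum_le_card_mul_sum_sq (s := D.erase 0) (f := fun t => (pinnedCount E v t : ℝ))
    have h4 : (24 : ℝ) * #(D.erase 0) ≤ Q := by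
      have h5 : (#(D.erase 0) : ℝ) ≤ #D := by exact_mod_cast card_le_card (erase_subset _ _)
      linarith [hcon v hv]
    calc _ ≤ 24 * (#(D.erase 0) * ∑ t ∈ D.erase 0, (pinnedCount E v t : ℝ) ^ 2) := by gcongr
      _ = (24 * #(D.erase 0)) * ∑ t ∈ D.erase 0, (pinnedCount E v t : ℝ) ^ 2 := by ring
      _ ≤ _ := by gcongr
  have h1 : (∑ v ∈ V, x v) ^ 2 ≤ A * ∑ v ∈ V, x v ^ 2 := sq_sum_le_card_mul_sum_sq
  have h2 : 24 * ∑ v ∈ V, x v ^ 2 ≤ Q * ∑ v ∈ V, X v := by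
    rw [mul_sum, mul_sum]
    exact sum_le_sum hxX
  have h3 : (A * B / 2) ^ 2 ≤ (∑ v ∈ V, x v) ^ 2 := by gcongr
  have h4 : A * (24 * ∑ v ∈ V, x v ^ 2) ≤ A * (3 * A * B ^ 2) :=
     mul_le_mul_of_nonneg_left (h2.trans hsX) hA0.le
  have h5 : 0 < (A * B) ^ 2 := by positivity
  nlinarith

theorem card_sph_le (hq : Fintype.card F % 4 = 3) {χ : AddChar F ℂ} (hχ : χ ≠ 1)
    {n h : ℕ} (hn : n = 2 * h) (hh : Odd h) (r : F) :
    (Fintype.card F : ℝ) * #(sph F n r) ≤ 2 * (Fintype.card F : ℝ) ^ n := by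
  have h1 : (Fintype.card F : ℂ) * #(sph F n r) =
      ∑ u, χ (-(u * r)) * ∑ m : Fin n → F, χ (u * nrm m) := by
    have : ∀ m : Fin n → F, ∑ u, χ (-(u * r)) * χ (u * nrm m) =
        if nrm m = r then (Fintype.card F : ℂ) else 0 := by
      intro m
      have := AddChar.sum_mulShift (nrm m - r) (AddChar.IsPrimitive.of_ne_one hχ)
      rw [Nat.cast_ite, Nat.cast_zero] at this
      simp only [sub_eq_zero] at this
      rw [← this]
      refine sum_congr rfl fun u _ => ?_
      rw [← AddChar.map_add_eq_mul]
      congr 1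
      ring
    simp_rw [mul_sum]
    rw [sum_comm, sum_congr rfl fun m _ => this m, ← sum_filter, sum_const, nsmul_eq_mul, mul_comm]
    rfl
  have h2 : ∀ u ∈ univ.erase (0 : F), ∑ m : Fin n → F, χ (u * nrm m) =
      -(Fintype.card F : ℂ) ^ h := by
    intro u hu
    have := sum_addChar_nrm hq hχ hn hh (mem_erase.1 hu).1 (0 : Fin n → F)
    simpa [dotP, nrm] using this
  have h3 := congrArg norm h1
  rw [← add_sum_erase univ _ (mem_univ (0 : F)), norm_mul, Complex.norm_natCast,
    Complex.norm_natCast] at h3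
  have h4 : ‖∑ u ∈ univ.erase (0 : F), χ (-(u * r)) * ∑ m : Fin n → F, χ (u * nrm m)‖ ≤
      (Fintype.card F : ℝ) * (Fintype.card F : ℝ) ^ h := by
    refine (norm_sum_le _ _).trans ?_
    rw [sum_congr rfl (g := fun _ => (Fintype.card F : ℝ) ^ h) fun u hu => by
      rw [h2 u hu, norm_mul, AddChar.norm_apply, norm_neg, norm_pow, Complex.norm_natCast, one_mul]]
    rw [sum_const, nsmul_eq_mul]
    gcongr
    exact card_le_univ _
  have h5 : (Fintype.card F : ℝ) * (Fintype.card F : ℝ) ^ h ≤ (Fintype.card F : ℝ) ^ n := by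
    rw [← pow_succ']
    refine pow_le_pow_right₀ ?_ ?_
    · exact_mod_cast Fintype.card_pos
    · have := hh.pos
      omega
  rw [h3]
  refine (norm_add_le _ _).trans ?_
  have h6 : ‖χ (-(0 * r)) * ∑ m : Fin n → F, χ (0 * nrm m)‖ = (Fintype.card F : ℝ) ^ n := by
    simp
  linarith

/-- An `L² → L^p` estimate, combined with Hölder's inequality on a finite set `V`, bounds the
`L²` norm over `V`. -/
theorem sum_norm_sq_le_of_rpow_le {α : Type*} [Fintype α] (V : Finset α) (Φ : α → ℂ)
    {S T C p : ℝ} (hS : 0 < S) (hT : 0 ≤ T) (hp : 2 < p)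
    (h : (∑ w, ‖(S : ℂ)⁻¹ * Φ w‖ ^ p) ^ (1 / p) ≤ C * (S⁻¹ * T) ^ ((1 : ℝ) / 2)) :
    ∑ v ∈ V, ‖Φ v‖ ^ 2 ≤ C ^ 2 * S * T * (#V : ℝ) ^ (1 - 2 / p) := by
  have hp0 : 0 < p := by linarith
  set g : α → ℝ := fun w => ‖(S : ℂ)⁻¹ * Φ w‖ with hg
  have hg0 : ∀ w, 0 ≤ g w := fun w => norm_nonneg _
  have hΦ : ∀ w, ‖Φ w‖ ^ 2 = S ^ 2 * g w ^ 2 := by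
    intro w
    rw [hg]
    simp only [norm_mul, norm_inv, Complex.norm_real, Real.norm_of_nonneg hS.le]
    field_simp
  have h1 := Real.rpow_sum_le_const_mul_sum_rpow V (fun w => g w ^ 2)
    (p := p / 2) (by linarith)
  have h2 : ∀ w, |g w ^ 2| ^ (p / 2) = g w ^ p := by
    intro w
    rw [abs_of_nonneg (by positivity), ← Real.rpow_natCast, ← Real.rpow_mul (hg0 w)]
    congr 1
    push_cast
    ring
  simp_rw [h2, abs_of_nonneg (sq_nonneg (g _))] at h1
  have hX0 : 0 ≤ ∑ v ∈ V, g v ^ 2 := sum_nonneg fun _ _ => by positivity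
  have hY0 : 0 ≤ ∑ w, g w ^ p := sum_nonneg fun w _ => Real.rpow_nonneg (hg0 w) _
  have h3 : (∑ v ∈ V, g v ^ 2) ^ (p / 2) ≤ (#V : ℝ) ^ (p / 2 - 1) * ∑ w, g w ^ p := by
    refine h1.trans (mul_le_mul_of_nonneg_left ?_ (by positivity))
    exact sum_le_sum_of_subset_of_nonneg (subset_univ _)
      fun w _ _ => Real.rpow_nonneg (hg0 w) _
  have h4 : ∑ v ∈ V, g v ^ 2 ≤ (#V : ℝ) ^ (1 - 2 / p) * ((∑ w, g w ^ p) ^ (1 / p)) ^ 2 := by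
    have := Real.rpow_le_rpow (by positivity) h3 (by positivity : 0 ≤ 2 / p)
    rw [← Real.rpow_mul hX0, show p / 2 * (2 / p) = 1 by field_simp, Real.rpow_one,
      Real.mul_rpow (by positivity) hY0, ← Real.rpow_mul (by positivity),
      show (p / 2 - 1) * (2 / p) = 1 - 2 / p by field_simp] at this
    rw [← Real.rpow_natCast (_ ^ (1 / p)), ← Real.rpow_mul hY0]
    convert this using 3
    push_cast
    ring
  have h5 : ((∑ w, g w ^ p) ^ (1 / p)) ^ 2 ≤ C ^ 2 * (S⁻¹ * T) := by
    have h6 := pow_le_pow_left₀ (Real.rpow_nonneg hY0 _) h 2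
    rwa [mul_pow, ← Real.rpow_natCast (_ ^ ((1 : ℝ) / 2)), ← Real.rpow_mul (by positivity),
      show (1 : ℝ) / 2 * (2 : ℕ) = 1 by norm_num, Real.rpow_one] at h6
  simp_rw [hΦ]
  rw [← mul_sum]
  calc _ ≤ S ^ 2 * ((#V : ℝ) ^ (1 - 2 / p) * (C ^ 2 * (S⁻¹ * T))) := by
        gcongr
        exact h4.trans (by gcongr)
    _ = _ := by field_simp

theorem mul_rpow_le_mul {L C q A B D : ℝ} (hD : 2 < D) (hq : 1 ≤ q) (hL : 1 ≤ L)
    (hCL : 2 * C ^ 2 ≤ L) (hA : L * q ^ ((D ^ 2 - 1) / (2 * D)) ≤ A)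
    (hB : L * q ^ ((D ^ 2 - 1) / (2 * D)) ≤ B) :
    2 * C ^ 2 * q ^ (D - 1) * A ^ (2 / (D + 1)) ≤ A * B := by
  have hq0 : 0 < q := by linarith
  set R := q ^ ((D ^ 2 - 1) / (2 * D)) with hR
  have hR0 : 0 < R := by positivity
  have hRA : R ≤ A := by nlinarith
  have hA0 : 0 < A := by linarith
  have h1 : q ^ (D - 1) = R ^ ((D - 1) / (D + 1)) * R := by
    rw [← Real.rpow_add_one hR0.ne', hR, ← Real.rpow_mul hq0.le]
    congr 1
    have : D + 1 ≠ 0 := by linarith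
    field_simp
    ring
  have h2 : A = A ^ ((D - 1) / (D + 1)) * A ^ (2 / (D + 1)) := by
    rw [← Real.rpow_add hA0, show (D - 1) / (D + 1) + 2 / (D + 1) = 1 by
      have : D + 1 ≠ 0 := by linarith
      field_simp
      ring, Real.rpow_one]
  have h3 : R ^ ((D - 1) / (D + 1)) ≤ A ^ ((D - 1) / (D + 1)) :=
    Real.rpow_le_rpow hR0.le hRA (div_nonneg (by linarith) (by linarith))
  have h4 : 2 * C ^ 2 * R ≤ B := (mul_le_mul_of_nonneg_right hCL hR0.le).trans hB
  calc _ = (2 * C ^ 2 * R) * (R ^ ((D - 1) / (D + 1)) * A ^ (2 / (D + 1))) := by rw [h1]; ring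
    _ ≤ B * (A ^ ((D - 1) / (D + 1)) * A ^ (2 / (D + 1))) := by
        have hB0 : 0 ≤ B := le_trans (by positivity) h4
        gcongr
    _ = _ := by rw [← h2, mul_comm]

/-- The conditional pinned distance theorem in `𝔽_q^{d-1}`. -/
theorem exists_card_pinned_le_of_extension {C₁ : ℝ} {d : ℕ} (hd : d % 4 = 3)
    (hq : Fintype.card F % 4 = 3) {χ : AddChar F ℂ} (hχ : χ ≠ 1)
    (hext : ∀ r : F, r ≠ 0 → ∀ f : (Fin (d - 1) → F) → ℂ,
      (∑ w : Fin (d - 1) → F,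
          ‖(((sph F (d - 1) r).card : ℂ))⁻¹ *
              ∑ x ∈ sph F (d - 1) r, χ (dotP w x) * f x‖ ^
            ((2 * (d : ℝ) + 2) / ((d : ℝ) - 1))) ^ (((d : ℝ) - 1) / (2 * (d : ℝ) + 2)) ≤
        C₁ * ((((sph F (d - 1) r).card : ℝ))⁻¹ *
            ∑ x ∈ sph F (d - 1) r, ‖f x‖ ^ 2) ^ ((1 : ℝ) / 2))
    (E V : Finset (Fin (d - 1) → F))
    (hV : (12 + 2 * C₁ ^ 2) * (Fintype.card F : ℝ) ^ (((d : ℝ) ^ 2 - 1) / (2 * (d : ℝ))) ≤ #V)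
    (hE : (12 + 2 * C₁ ^ 2) * (Fintype.card F : ℝ) ^ (((d : ℝ) ^ 2 - 1) / (2 * (d : ℝ))) ≤ #E) :
    ∃ v ∈ V, (Fintype.card F : ℝ) ≤ 24 * #(E.image fun y => nrm (y - v)) := by
  have hD : (2 : ℝ) < d := by
    have : 2 < d := by omega
    exact_mod_cast this
  have hd1 : ((d - 1 : ℕ) : ℝ) = (d : ℝ) - 1 := by
    rw [Nat.cast_sub (by omega), Nat.cast_one]
  obtain ⟨h, hn⟩ : ∃ h, d - 1 = 2 * h := ⟨(d - 1) / 2, by omega⟩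
  have hh : Odd h := Nat.odd_iff.2 (by omega)
  set q : ℝ := (Fintype.card F : ℝ) with hqdef
  have hq3 : 3 ≤ q := three_le_card_of_mod_four hq
  have hq0 : 0 < q := by linarith
  set K : ℝ := C₁ ^ 2 * (2 * q ^ (d - 1) / q) * (#V : ℝ) ^ (2 / ((d : ℝ) + 1)) with hK
  have hqpow : 12 * q ^ h ≤ (12 + 2 * C₁ ^ 2) * q ^ (((d : ℝ) ^ 2 - 1) / (2 * (d : ℝ))) := by
    have h1 : (12 : ℝ) ≤ 12 + 2 * C₁ ^ 2 := by nlinarith [sq_nonneg C₁]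
    have h2 : q ^ h ≤ q ^ (((d : ℝ) ^ 2 - 1) / (2 * (d : ℝ))) := by
      rw [← Real.rpow_natCast]
      refine Real.rpow_le_rpow_of_exponent_le (by linarith) ?_
      have h3 : (d : ℝ) - 1 = 2 * h := by
        rw [← hd1, hn]
        push_cast
        ring
      rw [le_div_iff₀ (by linarith)]
      nlinarith
    gcongr
  refine exists_card_pinned_le hq hχ hn hh E V K (fun r hr => ?_) (by positivity)
    (hqpow.trans hV) (hqpow.trans hE) ?_
  · set T := ∑ m ∈ sph F (d - 1) r, ‖∑ y ∈ E, χ (dotP m y)‖ ^ 2 with hT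
    have hT0 : 0 ≤ T := sum_nonneg fun _ _ => by positivity
    rcases (sph F (d - 1) r).eq_empty_or_nonempty with h0 | h0
    · simp [hT, sphereSum, h0]
    have hS : (0 : ℝ) < #(sph F (d - 1) r) := by exact_mod_cast h0.card_pos
    have h1 := hext r hr fun m => ∑ y ∈ E, χ (dotP m y)
    rw [← Equiv.sum_comp (Equiv.neg (Fin (d - 1) → F))] at h1
    have hp : ((d : ℝ) - 1) / (2 * (d : ℝ) + 2) = 1 / ((2 * (d : ℝ) + 2) / ((d : ℝ) - 1)) := by
      rw [one_div_div]
    rw [hp] at h1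
    have h2 := sum_norm_sq_le_of_rpow_le V (fun v => sphereSum χ E r v) hS hT0
      (p := (2 * (d : ℝ) + 2) / ((d : ℝ) - 1))
      (by rw [lt_div_iff₀ (by linarith)]; linarith)
      (by simpa [sphereSum] using h1)
    have h3 : (1 : ℝ) - 2 / ((2 * (d : ℝ) + 2) / ((d : ℝ) - 1)) = 2 / ((d : ℝ) + 1) := by
      have : (d : ℝ) - 1 ≠ 0 := by linarith
      have : (d : ℝ) + 1 ≠ 0 := by linarith
      have : 2 * (d : ℝ) + 2 ≠ 0 := by linarith
      field_simp
      ring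
    rw [h3] at h2
    have h4 : (#(sph F (d - 1) r) : ℝ) ≤ 2 * q ^ (d - 1) / q := by
      rw [le_div_iff₀ hq0, mul_comm]
      exact card_sph_le hq hχ hn hh r
    calc _ ≤ _ := h2
      _ ≤ C₁ ^ 2 * (2 * q ^ (d - 1) / q) * T * (#V : ℝ) ^ (2 / ((d : ℝ) + 1)) := by gcongr
      _ = _ := by rw [hK]; ring
  · have := mul_rpow_le_mul (C := C₁) hD (by linarith : 1 ≤ q)
      (by nlinarith [sq_nonneg C₁]) (by linarith) hV hE
    rw [← hd1, Real.rpow_natCast] at this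
    refine le_trans (le_of_eq ?_) this
    rw [hK, ← hqdef]
    field_simp

end CharacterSums

theorem nrm_sub {R : Type*} [CommRing R] {n : ℕ} (x y : Fin n → R) :
    nrm (x - y) = nrm x + nrm y - 2 * dotP x y := by
  simp only [nrm, dotP, mul_sum, ← sum_add_distrib, ← sum_sub_distrib, Pi.sub_apply]
  exact sum_congr rfl fun i _ => by ring

theorem nrm_smul {R : Type*} [CommRing R] {n : ℕ} (c : R) (x : Fin n → R) :
    nrm (c • x) = c ^ 2 * nrm x := by
  simp only [nrm, mul_sum, Pi.smul_apply, smul_eq_mul]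
  exact sum_congr rfl fun i _ => by ring

theorem dotP_smul_right {R : Type*} [CommRing R] {n : ℕ} (c : R) (x y : Fin n → R) :
    dotP x (c • y) = c * dotP x y := by
  simp only [dotP, mul_sum, Pi.smul_apply, smul_eq_mul]
  exact sum_congr rfl fun i _ => by ring

/-- Inversion `x ↦ -x / (2‖x‖)` is injective on vectors of nonzero norm. -/
theorem injOn_inversion {F : Type*} [Field F] (h2 : (2 : F) ≠ 0) {n : ℕ} :
    Set.InjOn (fun x : Fin n → F => (-(2 * nrm x)⁻¹) • x) {x | nrm x ≠ 0} := by
  have hinv : ∀ x : Fin n → F, nrm x ≠ 0 →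
      (-(2 * nrm ((-(2 * nrm x)⁻¹) • x))⁻¹) • ((-(2 * nrm x)⁻¹) • x) = x := by
    intro x hx
    rw [nrm_smul, smul_smul]
    convert one_smul F x using 2
    field_simp
  intro x hx y hy hxy
  have hxy : (-(2 * nrm x)⁻¹) • x = (-(2 * nrm y)⁻¹) • y := hxy
  rw [← hinv x hx, hxy, hinv y hy]

/-- If pinned distances are plentiful for all pairs of sets with at least `N` points, then so are
the dot products `x·y + ‖x‖‖y‖` of points of the paraboloid lying over `E`. -/
theorem card_le_dot_of_pinned {F : Type*} [Field F] [DecidableEq F] (h2 : (2 : F) ≠ 0)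
    {n : ℕ} {N q : ℝ} (E : Finset (Fin n → F)) (D : Finset F) (hE : 2 * N ≤ #E) (hN : 0 ≤ N)
    (hD : ∀ x ∈ E, ∀ y ∈ E, dotP x y + nrm x * nrm y ∈ D)
    (hpin : ∀ E V : Finset (Fin n → F), N ≤ #V → N ≤ #E →
      ∃ v ∈ V, q ≤ 24 * #(E.image fun y => nrm (y - v))) :
    q ≤ 24 * #D := by
  have hcard : (#{x ∈ E | nrm x = 0} : ℝ) + #{x ∈ E | ¬ nrm x = 0} = #E := by
    exact_mod_cast card_filter_add_card_filter_not (s := E) (fun x => nrm x = 0)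
  have hfinish : ∀ (G : Finset (Fin n → F)) (v : Fin n → F) (g : F → F), g.Injective →
      (∀ y ∈ G, g (nrm (y - v)) ∈ D) → q ≤ 24 * #(G.image fun y => nrm (y - v)) →
      q ≤ 24 * #D := by
    intro G v g hg hgD hq
    have : #(G.image fun y => nrm (y - v)) ≤ #D := by
      refine card_le_card_of_injOn g (fun t ht => ?_) hg.injOn
      obtain ⟨y, hy, rfl⟩ := mem_image.1 ht
      exact hgD y hy
    have : (#(G.image fun y => nrm (y - v)) : ℝ) ≤ #D := by exact_mod_cast this
    linarith
  by_cases hcase : N ≤ #{x ∈ E | nrm x = 0}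
  · obtain ⟨v, hv, hqv⟩ := hpin _ _ hcase hcase
    obtain ⟨hvE, hv0⟩ := mem_filter.1 hv
    refine hfinish _ v (fun t => -(2 : F)⁻¹ * t) (mul_right_injective₀ (by simpa using h2))
      (fun y hy => ?_) hqv
    obtain ⟨hyE, hy0⟩ := mem_filter.1 hy
    convert hD y hyE v hvE using 1
    rw [nrm_sub, hv0, hy0]
    field_simp
    ring
  · set W : Finset (Fin n → F) := {x ∈ E | ¬ nrm x = 0} with hW
    have hWN : N ≤ #(W.image fun x => (-(2 * nrm x)⁻¹) • x) := by
      rw [card_image_of_injOn]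
      · linarith
      · exact (injOn_inversion h2).mono fun x hx => (mem_filter.1 hx).2
    obtain ⟨v, hv, hqv⟩ := hpin E _ hWN (by linarith [hN])
    obtain ⟨x, hx, rfl⟩ := mem_image.1 hv
    obtain ⟨hxE, hx0⟩ := mem_filter.1 hx
    refine hfinish _ _ (fun t => nrm x * t - (4 : F)⁻¹)
      (fun s t hst => mul_left_cancel₀ hx0 (sub_left_injective hst)) (fun y hy => ?_) hqv
    convert hD y hy x hxE using 1
    have h4 : (4 : F) = 2 * 2 := by norm_num
    rw [nrm_sub, nrm_smul, dotP_smul_right, h4]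
    field_simp
    ring

/-- conditional on the `L² → L^{(2d+2)/(d-1)}` extension conjecture for
spheres of nonzero radius in `𝔽_q^{d-1}`, for `d ≡ 3 (mod 4)`, `q ≡ 3 (mod 4)` and
`E ⊆ P_d`, if `|E| ≥ C q^{(d²-1)/(2d)}` then `|∏(E)| ≥ c q`. -/
theorem stmt1 (C₁ : ℝ) (hC₁ : 0 < C₁) :
    ∃ C c : ℝ, 0 < C ∧ 0 < c ∧
      ∀ (F : Type) [Field F] [Fintype F] [DecidableEq F] (d : ℕ)
        (hd : d % 4 = 3) (hq : Fintype.card F % 4 = 3)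
        (χ : AddChar F ℂ) (hχ : χ ≠ 1),
        -- the extension estimate hypothesis for every sphere of nonzero radius in 𝔽_q^{d-1}
        (∀ r : F, r ≠ 0 → ∀ f : (Fin (d - 1) → F) → ℂ,
          (∑ w : Fin (d - 1) → F,
              ‖(((sph F (d - 1) r).card : ℂ))⁻¹ *
                  ∑ x ∈ sph F (d - 1) r, χ (dotP w x) * f x‖ ^
                ((2 * (d : ℝ) + 2) / ((d : ℝ) - 1))) ^ (((d : ℝ) - 1) / (2 * (d : ℝ) + 2)) ≤
            C₁ * ((((sph F (d - 1) r).card : ℝ))⁻¹ *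
                ∑ x ∈ sph F (d - 1) r, ‖f x‖ ^ 2) ^ ((1 : ℝ) / 2)) →
        ∀ E : Finset (Fin d → F),
          -- E is a subset of the paraboloid P_d
          (∀ x ∈ E, x ⟨d - 1, by omega⟩ =
            ∑ i : Fin (d - 1), x (Fin.castLE (by omega) i) ^ 2) →
          C * (Fintype.card F : ℝ) ^ (((d : ℝ) ^ 2 - 1) / (2 * (d : ℝ))) ≤ (E.card : ℝ) →
          c * (Fintype.card F : ℝ) ≤ ((prodSet E).card : ℝ) := by
  refine ⟨2 * (12 + 2 * C₁ ^ 2), 1 / 24, by positivity, by norm_num, ?_⟩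
  intro F _ _ _ d hd hq χ hχ hext E hE hcard
  obtain ⟨n, rfl⟩ : ∃ n, d = n + 1 := ⟨d - 1, by omega⟩
  set N : ℝ := (12 + 2 * C₁ ^ 2) *
    (Fintype.card F : ℝ) ^ ((((n + 1 : ℕ) : ℝ) ^ 2 - 1) / (2 * ((n + 1 : ℕ) : ℝ)))
  have hlast : ∀ x ∈ E, x (Fin.last n) = nrm fun i : Fin n => x i.castSucc := by
    intro x hx
    refine (hE x hx).trans (sum_congr rfl fun i _ => ?_)
    rw [sq]
    rfl
  have hinj : Set.InjOn (fun (x : Fin (n + 1) → F) (i : Fin n) => x i.castSucc) E := by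
    intro x hx y hy hxy
    have hxy : (fun i : Fin n => x i.castSucc) = fun i : Fin n => y i.castSucc := hxy
    funext i
    refine Fin.lastCases ?_ (fun j => congrFun hxy j) i
    rw [hlast x hx, hlast y hy, hxy]
  have key := card_le_dot_of_pinned (two_ne_zero_of_card_mod_four hq)
    (N := N) (q := (Fintype.card F : ℝ))
    (E.image fun (x : Fin (n + 1) → F) (i : Fin n) => x i.castSucc) (prodSet E)
    (by rw [card_image_of_injOn hinj]; linarith) (by positivity) ?_
    (fun E V hV hE => exists_card_pinned_le_of_extension hd hq hχ hext E V hV hE)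
  · linarith
  · intro x hx y hy
    obtain ⟨x, hxE, rfl⟩ := mem_image.1 hx
    obtain ⟨y, hyE, rfl⟩ := mem_image.1 hy
    refine mem_image.2 ⟨(x, y), mk_mem_product hxE hyE, ?_⟩
    rw [← hlast x hxE, ← hlast y hyE, dotP, Fin.sum_univ_castSucc]
    rfl
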